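/- (SE(3) equivariance of EquiContact; main Proposition.) Under the setup of the body-frame EquiContact policy — π any function mapping the GCEV observation (Rᵀ(p − p_ref), R_refᵀ R − Rᵀ R_ref) and a body-frame force-torque reading F_e ∈ ℝ⁶ to a relative pose (q, S) with S ∈ SO(3) and gains (K_p, symmetric K_R); desired pose g_d(g, g_ref, F_e) = g · (q, S); h(g, g_ref, F_e) the resulting body-frame geometric elastic wrench — define the spatial-frame output h^s(g, g_ref, F_e) = Ad(g⁻¹)ᵀ · h(g, g_ref, F_e). Then for every g_l ∈ SE(3): h^s(g_l · g, g_l · g_ref, F_e) = Ad(g_l⁻¹)ᵀ · h^s(g, g_ref, F_e). -/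

import Mathlib

open Matrix

/-- An SE(3) element as a pair of a position in `ℝ³` and a `3×3` rotation matrix. -/
abbrev SE3 : Type := (Fin 3 → ℝ) × Matrix (Fin 3) (Fin 3) ℝ

/-- SE(3) multiplication: `(p₁, R₁) · (p₂, R₂) = (p₁ + R₁ p₂, R₁ R₂)`. -/
def se3Mul (g₁ g₂ : SE3) : SE3 := (g₁.1 + g₁.2 *ᵥ g₂.1, g₁.2 * g₂.2)

/-- SE(3) inverse: `(p, R)⁻¹ = (−Rᵀ p, Rᵀ)`. -/
def se3Inv (g : SE3) : SE3 := (-(g.2ᵀ *ᵥ g.1), g.2ᵀ)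

/-- Membership in SO(3): orthogonal with determinant one. -/
def IsSO3 (R : Matrix (Fin 3) (Fin 3) ℝ) : Prop := Rᵀ * R = 1 ∧ R.det = 1

/-- The geometrically consistent error vector (GCEV) between a current pose
`g = (p, R)` and a reference pose `g_ref = (p_ref, R_ref)`. -/
def gcev (g gref : SE3) : (Fin 3 → ℝ) × Matrix (Fin 3) (Fin 3) ℝ :=
  (g.2ᵀ *ᵥ (g.1 - gref.1), gref.2ᵀ * g.2 - g.2ᵀ * gref.2)

/-- The cross-product (hat) matrix of `v ∈ ℝ³`, satisfying `hat v *ᵥ w = v ×₃ w`. -/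
def hat (v : Fin 3 → ℝ) : Matrix (Fin 3) (Fin 3) ℝ :=
  !![0, -v 2, v 1;
     v 2, 0, -v 0;
     -v 1, v 0, 0]

/-- The vee map, inverse of `hat` on skew-symmetric matrices. -/
def vee (M : Matrix (Fin 3) (Fin 3) ℝ) : Fin 3 → ℝ := ![M 2 1, M 0 2, M 1 0]

/-- The adjoint matrix of `g = (p, R)`: the `6×6` block matrix
`Ad(g) = [[R, hat(p)·R], [0, R]]`. -/
def Ad (g : SE3) : Matrix (Fin 3 ⊕ Fin 3) (Fin 3 ⊕ Fin 3) ℝ :=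
  Matrix.fromBlocks g.2 (hat g.1 * g.2) 0 g.2

/-- The body-frame geometric elastic wrench of `g = (p, R)` relative to a desired
pose `g_d = (p_d, R_d)` with gains `K_p, K_R`. -/
def elasticWrench (Kp KR : Matrix (Fin 3) (Fin 3) ℝ) (g gd : SE3) :
    (Fin 3 ⊕ Fin 3) → ℝ :=
  Sum.elim ((g.2ᵀ * gd.2 * Kp * gd.2ᵀ) *ᵥ (g.1 - gd.1))
    (vee (KR * gd.2ᵀ * g.2 - g.2ᵀ * gd.2 * KR))

/-- The body-frame output wrench of the EquiContact policy `π`: the geometric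
elastic wrench of `g` relative to `g_d = g · (pose part of π(e_G(g, g_ref), F_e))`,
with the gains output by `π`. -/
def equiContactWrench
    (π : (Fin 3 → ℝ) × Matrix (Fin 3) (Fin 3) ℝ → (Fin 6 → ℝ) →
      SE3 × Matrix (Fin 3) (Fin 3) ℝ × Matrix (Fin 3) (Fin 3) ℝ)
    (g gref : SE3) (Fe : Fin 6 → ℝ) : (Fin 3 ⊕ Fin 3) → ℝ :=
  elasticWrench (π (gcev g gref) Fe).2.1 (π (gcev g gref) Fe).2.2
    g (se3Mul g (π (gcev g gref) Fe).1)

/-- The spatial-frame output of EquiContact: `h^s(g, g_ref, F_e) = Ad(g⁻¹)ᵀ · h(g, g_ref, F_e)`. -/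
def equiContactWrenchSpatial
    (π : (Fin 3 → ℝ) × Matrix (Fin 3) (Fin 3) ℝ → (Fin 6 → ℝ) →
      SE3 × Matrix (Fin 3) (Fin 3) ℝ × Matrix (Fin 3) (Fin 3) ℝ)
    (g gref : SE3) (Fe : Fin 6 → ℝ) : (Fin 3 ⊕ Fin 3) → ℝ :=
  (Ad (se3Inv g))ᵀ *ᵥ equiContactWrench π g gref Fe

theorem hat_add (v w : Fin 3 → ℝ) : hat (v + w) = hat v + hat w := by
  ext i j
  fin_cases i <;> fin_cases j <;> simp [hat, add_comm]

theorem transpose_mul_hat_mulVec_mul (R : Matrix (Fin 3) (Fin 3) ℝ) (v : Fin 3 → ℝ) :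
    Rᵀ * hat (R *ᵥ v) * R = R.det • hat v := by
  ext i j
  fin_cases i <;> fin_cases j <;>
    simp [hat, Matrix.mul_apply, Matrix.mulVec, dotProduct, Fin.sum_univ_three,
      Matrix.det_fin_three] <;> ring

theorem IsSO3.mul_transpose {R : Matrix (Fin 3) (Fin 3) ℝ} (hR : IsSO3 R) : R * Rᵀ = 1 :=
  mul_eq_one_comm.mp hR.1

theorem IsSO3.transpose {R : Matrix (Fin 3) (Fin 3) ℝ} (hR : IsSO3 R) : IsSO3 Rᵀ :=
  ⟨by rw [transpose_transpose, hR.mul_transpose], by rw [det_transpose, hR.2]⟩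

theorem IsSO3.hat_mulVec_mul {R : Matrix (Fin 3) (Fin 3) ℝ} (hR : IsSO3 R)
    (v : Fin 3 → ℝ) : hat (R *ᵥ v) * R = R * hat v := by
  have h := transpose_mul_hat_mulVec_mul R v
  rw [hR.2, one_smul] at h
  rw [← h, Matrix.mul_assoc, ← Matrix.mul_assoc R, hR.mul_transpose, Matrix.one_mul]

/-- The adjoint representation is multiplicative. -/
theorem Ad_se3Mul (a b : SE3) (ha : IsSO3 a.2) : Ad (se3Mul a b) = Ad a * Ad b := by
  have h : hat (a.1 + a.2 *ᵥ b.1) * (a.2 * b.2)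
      = a.2 * (hat b.1 * b.2) + hat a.1 * a.2 * b.2 := by
    rw [hat_add, Matrix.add_mul, ← Matrix.mul_assoc (hat (a.2 *ᵥ b.1)), ha.hat_mulVec_mul,
      Matrix.mul_assoc a.2, ← Matrix.mul_assoc (hat a.1), add_comm]
  simp [Ad, se3Mul, fromBlocks_multiply, h]

theorem se3Inv_se3Mul (a b : SE3) (ha : IsSO3 a.2) :
    se3Inv (se3Mul a b) = se3Mul (se3Inv b) (se3Inv a) := by
  simp only [se3Inv, se3Mul, transpose_mul, Prod.mk.injEq, and_true]
  rw [mulVec_add, mulVec_mulVec, Matrix.mul_assoc, ha.1, Matrix.mul_one, mulVec_neg,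
    mulVec_mulVec, neg_add, add_comm]

theorem se3Mul_assoc (a b c : SE3) : se3Mul (se3Mul a b) c = se3Mul a (se3Mul b c) := by
  simp [se3Mul, mulVec_add, mulVec_mulVec, Matrix.mul_assoc, add_assoc]

theorem IsSO3.transpose_mul_cancel_left {R : Matrix (Fin 3) (Fin 3) ℝ} (hR : IsSO3 R)
    (A : Matrix (Fin 3) (Fin 3) ℝ) : Rᵀ * (R * A) = A := by
  rw [← Matrix.mul_assoc, hR.1, Matrix.one_mul]

theorem se3Mul_fst_sub (a b c : SE3) :
    (se3Mul a b).1 - (se3Mul a c).1 = a.2 *ᵥ (b.1 - c.1) := by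
  simp [se3Mul, mulVec_sub]

/-- The GCEV is invariant under left translations. -/
theorem gcev_se3Mul (a g gref : SE3) (ha : IsSO3 a.2) :
    gcev (se3Mul a g) (se3Mul a gref) = gcev g gref := by
  have hs (b : SE3) : (se3Mul a b).2 = a.2 * b.2 := rfl
  simp only [gcev, se3Mul_fst_sub, hs, mulVec_mulVec, transpose_mul, Matrix.mul_assoc,
    ha.transpose_mul_cancel_left, ha.1, Matrix.mul_one]

/-- The body-frame elastic wrench is invariant under left translations. -/
theorem elasticWrench_se3Mul (Kp KR : Matrix (Fin 3) (Fin 3) ℝ) (a g gd : SE3)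
    (ha : IsSO3 a.2) :
    elasticWrench Kp KR (se3Mul a g) (se3Mul a gd) = elasticWrench Kp KR g gd := by
  have hs (b : SE3) : (se3Mul a b).2 = a.2 * b.2 := rfl
  simp only [elasticWrench, se3Mul_fst_sub, hs, mulVec_mulVec, transpose_mul,
    Matrix.mul_assoc, ha.transpose_mul_cancel_left, ha.1, Matrix.mul_one]

theorem equiContactWrench_se3Mul
    (π : (Fin 3 → ℝ) × Matrix (Fin 3) (Fin 3) ℝ → (Fin 6 → ℝ) →
      SE3 × Matrix (Fin 3) (Fin 3) ℝ × Matrix (Fin 3) (Fin 3) ℝ)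
    (a g gref : SE3) (ha : IsSO3 a.2) (Fe : Fin 6 → ℝ) :
    equiContactWrench π (se3Mul a g) (se3Mul a gref) Fe = equiContactWrench π g gref Fe := by
  simp only [equiContactWrench, gcev_se3Mul a g gref ha, se3Mul_assoc,
    elasticWrench_se3Mul _ _ a _ _ ha]

/-- SE(3) equivariance of EquiContact (main Proposition): for every `g_l ∈ SE(3)`,
`h^s(g_l · g, g_l · g_ref, F_e) = Ad(g_l⁻¹)ᵀ · h^s(g, g_ref, F_e)`. -/
theorem equiContact_spatial_equivariant
    (π : (Fin 3 → ℝ) × Matrix (Fin 3) (Fin 3) ℝ → (Fin 6 → ℝ) →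
      SE3 × Matrix (Fin 3) (Fin 3) ℝ × Matrix (Fin 3) (Fin 3) ℝ)
    (hπ : ∀ e Fe, IsSO3 (π e Fe).1.2 ∧ ((π e Fe).2.2)ᵀ = (π e Fe).2.2)
    (g gref gl : SE3)
    (hg : IsSO3 g.2) (hgref : IsSO3 gref.2) (hgl : IsSO3 gl.2)
    (Fe : Fin 6 → ℝ) :
    equiContactWrenchSpatial π (se3Mul gl g) (se3Mul gl gref) Fe
      = (Ad (se3Inv gl))ᵀ *ᵥ equiContactWrenchSpatial π g gref Fe := by
  rw [equiContactWrenchSpatial, equiContactWrenchSpatial, equiContactWrench_se3Mul π gl g gref hgl,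
    se3Inv_se3Mul gl g hgl, Ad_se3Mul _ _ hg.transpose, transpose_mul, mulVec_mulVec]
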